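/- Let n, d ≥ 1, let f, f̃ : ℝⁿ → ℝᵈ be injective Borel-measurable maps, let π, π̃ : ℝⁿ → ℝ≥0 be Lebesgue-integrable probability densities on ℝⁿ, and let p_ε : ℝᵈ → ℝ be Lebesgue-integrable such that the set {ω ∈ ℝᵈ : ĝ(ω) = 0} has Lebesgue measure zero, where ĝ is the Fourier transform of p_ε. If ∫_{ℝⁿ} p_ε(x − f(c)) π(c) dc = ∫_{ℝⁿ} p_ε(x − f̃(c)) π̃(c) dc for Lebesgue-almost every x ∈ ℝᵈ, then the pushforward of the measure with density π (with respect to Lebesgue measure on ℝⁿ) under f equals the pushforward of the measure with density π̃ under f̃, as Borel measures on ℝᵈ. -/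

import Mathlib

open MeasureTheory
open scoped FourierTransform

/-- The Fourier transform of the mixture of translates `∫ c, g (x - φ c) * w c ∂ν` of `g` is the
product of the Fourier transform of `g` with that of the image under `φ` of the weight `w`. -/
theorem fourier_integral_comp_sub_mul {E Ω : Type*} [NormedAddCommGroup E] [InnerProductSpace ℝ E]
    [FiniteDimensional ℝ E] [MeasurableSpace E] [BorelSpace E] [MeasurableSpace Ω]
    {ν : Measure Ω} [SFinite ν] {g : E → ℂ} (hg : Integrable g) {φ : Ω → E} (hφ : Measurable φ)
    {w : Ω → ℂ} (hw : Integrable w ν) (ω : E) :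
    𝓕 (fun x => ∫ c, g (x - φ c) * w c ∂ν) ω =
      𝓕 g ω * ∫ c, Complex.exp (↑(-2 * Real.pi * inner ℝ (φ c) ω) * Complex.I) * w c ∂ν := by
  have hshear : MeasurePreserving (fun p : Ω × E => (p.1, p.2 - φ p.1))
      (ν.prod volume) (ν.prod volume) := by
    refine (MeasurePreserving.id ν).skew_product (g := fun c x => x - φ c) ?_ ?_
    · exact measurable_snd.sub (hφ.comp measurable_fst)
    · exact .of_forall fun c => (measurePreserving_sub_right volume (φ c)).map_eq
  have hint : Integrable (fun p : Ω × E => g (p.2 - φ p.1) * w p.1) (ν.prod volume) := by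
    have := hshear.integrable_comp_of_integrable (hw.mul_prod hg)
    simpa [Function.comp_def, mul_comm] using this
  have hexp : Integrable (fun p : Ω × E =>
      Complex.exp (↑(-2 * Real.pi * inner ℝ p.2 ω) * Complex.I) * (g (p.2 - φ p.1) * w p.1))
      (ν.prod volume) := by
    refine hint.bdd_mul (c := 1) (by fun_prop) (.of_forall fun p => ?_)
    rw [Complex.norm_exp_ofReal_mul_I]
  simp only [Real.fourier_eq', smul_eq_mul]
  simp_rw [← integral_const_mul]
  rw [← integral_integral_swap hexp]
  refine integral_congr_ae (.of_forall fun c => ?_)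
  dsimp only
  rw [← integral_add_right_eq_self _ (φ c), ← integral_mul_const]
  refine integral_congr_ae (.of_forall fun x => ?_)
  have h : ((-2 * Real.pi * inner ℝ (x + φ c) ω : ℝ) : ℂ) * Complex.I =
      ((-2 * Real.pi * inner ℝ x ω : ℝ) : ℂ) * Complex.I +
      ((-2 * Real.pi * inner ℝ (φ c) ω : ℝ) : ℂ) * Complex.I := by
    rw [inner_add_left]; push_cast; ring
  simp only [h, Complex.exp_add, add_sub_cancel_right]
  ring

/-- The characteristic function of the image under `φ` of the measure with density `w`. -/
theorem charFun_map_withDensity_ofReal {E Ω : Type*} [NormedAddCommGroup E] [InnerProductSpace ℝ E]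
    [MeasurableSpace E] [BorelSpace E] [SecondCountableTopology E] [MeasurableSpace Ω]
    {ν : Measure Ω} {φ : Ω → E} (hφ : Measurable φ)
    {w : Ω → ℝ} (hw : Integrable w ν) (hw0 : ∀ c, 0 ≤ w c) (t : E) :
    charFun (Measure.map φ (ν.withDensity fun c => ENNReal.ofReal (w c))) t =
      ∫ c, Complex.exp (↑(inner ℝ (φ c) t : ℝ) * Complex.I) * (w c : ℂ) ∂ν := by
  rw [charFun_apply, integral_map hφ.aemeasurable (by fun_prop),
    integral_withDensity_eq_integral_toReal_smul₀ hw.aemeasurable.ennreal_ofReal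
      (.of_forall fun _ => ENNReal.ofReal_lt_top)]
  refine integral_congr_ae (.of_forall fun c => ?_)
  simp [ENNReal.toReal_ofReal (hw0 c), mul_comm]

/-- **Step I conclusion.** If the observed (noisy) densities of the two latent variable
models `x = f(c) + ε` and `x = f̃(c̃) + ε` agree almost everywhere, and the characteristic
function of the noise density `p_ε` vanishes only on a null set, then the noise-free
distributions agree: the pushforward under `f` of the measure with density `π` equals the
pushforward under `f̃` of the measure with density `π̃`. -/
theorem pushforward_eq_of_noisy_densities_eq
    (n d : ℕ) (hn : 1 ≤ n) (hd : 1 ≤ d)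
    (f f' : EuclideanSpace ℝ (Fin n) → EuclideanSpace ℝ (Fin d))
    (hfm : Measurable f) (hf'm : Measurable f')
    (hfinj : Function.Injective f) (hf'inj : Function.Injective f')
    (π π' : EuclideanSpace ℝ (Fin n) → ℝ)
    (hπ0 : ∀ c, 0 ≤ π c) (hπ'0 : ∀ c, 0 ≤ π' c)
    (hπint : Integrable π) (hπ'int : Integrable π')
    (hπ1 : ∫ c, π c = 1) (hπ'1 : ∫ c, π' c = 1)
    (pe : EuclideanSpace ℝ (Fin d) → ℝ) (hpe : Integrable pe)
    (hfour : volume {ω : EuclideanSpace ℝ (Fin d) | 𝓕 (fun x => (pe x : ℂ)) ω = 0} = 0)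
    (heq : ∀ᵐ x ∂(volume : Measure (EuclideanSpace ℝ (Fin d))),
      ∫ c, pe (x - f c) * π c = ∫ c, pe (x - f' c) * π' c) :
    Measure.map f (volume.withDensity fun c => ENNReal.ofReal (π c)) =
      Measure.map f' (volume.withDensity fun c => ENNReal.ofReal (π' c)) := by
  set μ := Measure.map f (volume.withDensity fun c => ENNReal.ofReal (π c))
  set μ' := Measure.map f' (volume.withDensity fun c => ENNReal.ofReal (π' c))
  have : IsFiniteMeasure (volume.withDensity fun c => ENNReal.ofReal (π c)) :=
    isFiniteMeasure_withDensity_ofReal hπint.2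
  have : IsFiniteMeasure (volume.withDensity fun c => ENNReal.ofReal (π' c)) :=
    isFiniteMeasure_withDensity_ofReal hπ'int.2
  have hscale (φ : EuclideanSpace ℝ (Fin n) → EuclideanSpace ℝ (Fin d))
      (hφ : Measurable φ) (w : EuclideanSpace ℝ (Fin n) → ℝ) (hw : Integrable w)
      (hw0 : ∀ c, 0 ≤ w c) (ω : EuclideanSpace ℝ (Fin d)) :
      𝓕 (fun x => ((∫ c, pe (x - φ c) * w c : ℝ) : ℂ)) ω = 𝓕 (fun x => (pe x : ℂ)) ω *
        charFun (Measure.map φ (volume.withDensity fun c => ENNReal.ofReal (w c)))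
          ((-2 * Real.pi) • ω) := by
    rw [charFun_map_withDensity_ofReal hφ hw hw0]
    simp_rw [inner_smul_right]
    refine Eq.trans ?_ (fourier_integral_comp_sub_mul (g := fun x => (pe x : ℂ))
      (w := fun c => (w c : ℂ)) hpe.ofReal hφ hw.ofReal ω)
    simp_rw [← integral_complex_ofReal, Complex.ofReal_mul]
  have hfourier (ω : EuclideanSpace ℝ (Fin d)) :
      𝓕 (fun x => (pe x : ℂ)) ω * charFun μ ((-2 * Real.pi) • ω) =
        𝓕 (fun x => (pe x : ℂ)) ω * charFun μ' ((-2 * Real.pi) • ω) := by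
    rw [← hscale f hfm π hπint hπ0, ← hscale f' hf'm π' hπ'int hπ'0]
    refine Real.fourier_congr_ae ?_ ω
    filter_upwards [heq] with x hx
    rw [hx]
  have hcont (ρ : Measure (EuclideanSpace ℝ (Fin d))) [IsFiniteMeasure ρ] :
      Continuous fun ω => charFun ρ ((-2 * Real.pi) • ω) :=
    continuous_charFun.comp (continuous_const_smul _)
  have hall : (fun ω => charFun μ ((-2 * Real.pi) • ω)) =
      fun ω => charFun μ' ((-2 * Real.pi) • ω) := by
    refine (Continuous.ae_eq_iff_eq volume (hcont μ) (hcont μ')).1 ?_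
    have hne : ∀ᵐ ω : EuclideanSpace ℝ (Fin d), 𝓕 (fun x => (pe x : ℂ)) ω ≠ 0 := by
      simpa [ae_iff] using hfour
    filter_upwards [hne] with ω hω
    exact mul_left_cancel₀ hω (hfourier ω)
  refine Measure.ext_of_charFun (funext fun t => ?_)
  have h2π : (-2 * Real.pi) ≠ 0 := by simp [Real.pi_ne_zero]
  simpa only [smul_inv_smul₀ h2π] using congrFun hall ((-2 * Real.pi)⁻¹ • t)
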